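/- The skew product T:R→R admits a unique T-invariant Borel probability measure that is absolutely continuous with respect to Lebesgue measure on R; this invariant measure is ergodic under T, and its topological support equals the whole rectangle R. -/

import Mathlib

noncomputable section

open Set Filter MeasureTheory Topology

/-- The Gauss map `G(ρ) = {1/ρ}`, `G(0) = 0`. -/
def gaussMap (ρ : ℝ) : ℝ := if ρ = 0 then 0 else Int.fract (1 / ρ)

/-- The fiber maps `T_ρ : [-1,1] → [-1,1]` of the skew product. -/
def fiberMap (ρ α : ℝ) : ℝ :=
  if ρ = 0 then 0
  else if α ≤ 0 then -α
  else if α ≤ ρ * gaussMap ρ then -α / (ρ * gaussMap ρ)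
  else Int.fract ((1 - α) / ρ)

/-- The skew product `T(ρ,α) = (G(ρ), T_ρ(α))`. -/
def skewProd (p : ℝ × ℝ) : ℝ × ℝ := (gaussMap p.1, fiberMap p.1 p.2)

/-- The rectangle `R = [0,1] × [-1,1]`. -/
def Rect : Set (ℝ × ℝ) := Icc (0 : ℝ) 1 ×ˢ Icc (-1 : ℝ) 1

/-- `M = ([0,1] ∖ ℚ) × [-1,1]`. -/
def Mset : Set (ℝ × ℝ) := {p | p ∈ Rect ∧ Irrational p.1}

/-- The `n`-th partial quotient of the continued fraction expansion of `θ`: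
`a_n(θ) = ⌊1 / Gⁿ(θ)⌋`. -/
def pquot (θ : ℝ) (n : ℕ) : ℕ := ⌊1 / gaussMap^[n] θ⌋₊

/-- The set `𝔼_∞` of irrational numbers in `(0,1)` all of whose partial quotients are even
and tend to infinity. -/
def Einf : Set ℝ :=
  {θ | θ ∈ Ioo (0 : ℝ) 1 ∧ Irrational θ ∧ (∀ n, Even (pquot θ n)) ∧
    Tendsto (fun n => pquot θ n) atTop atTop}

/-! ### Change of variables in one dimension -/

lemma lintegral_Ioo_add_Ioo {a b c : ℝ} (hab : a ≤ b) (hbc : b ≤ c) (F : ℝ → ENNReal) :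
    ∫⁻ x in Ioo a c, F x = (∫⁻ x in Ioo a b, F x) + ∫⁻ x in Ioo b c, F x := by
  simp only [restrict_Ioo_eq_restrict_Ioc]
  rw [← Ioc_union_Ioc_eq_Ioc hab hbc, lintegral_union measurableSet_Ioc]
  exact Set.disjoint_left.2 fun x hx hx' => not_lt.2 hx.2 hx'.1

lemma lintegral_Ioo_affine {r : ℝ} (hr : 0 < r) (b x y : ℝ) (F : ℝ → ENNReal) :
    ∫⁻ α in Ioo (b - r * y) (b - r * x), F α =
      ∫⁻ β in Ioo x y, ENNReal.ofReal r * F (b - r * β) := by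
  have himg : (fun β => b - r * β) '' Ioo x y = Ioo (b - r * y) (b - r * x) := by
    ext α
    constructor
    · rintro ⟨β, ⟨h1, h2⟩, rfl⟩
      constructor <;> nlinarith
    · rintro ⟨h1, h2⟩
      refine ⟨(b - α) / r, ⟨?_, ?_⟩, by field_simp; ring⟩
      · rw [lt_div_iff₀ hr]; linarith
      · rw [div_lt_iff₀ hr]; linarith
  rw [← himg, lintegral_image_eq_lintegral_abs_deriv_mul (f' := fun _ => -r) measurableSet_Ioo]
  · simp [abs_of_pos hr]
  · intro β _
    have h := ((hasDerivAt_id β).const_mul r).const_sub b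
    simpa using h.hasDerivWithinAt
  · intro β _ β' _ h
    have : r * β = r * β' := by simpa using h
    exact mul_left_cancel₀ hr.ne' this

/-- Change of variables along the inverse branches of the Gauss map. -/
lemma lintegral_gauss_branches (g : ℝ → ENNReal) :
    ∫⁻ x in Ioo (0 : ℝ) 1, g x =
      ∑' m : ℕ, ∫⁻ s in Ioo (0 : ℝ) 1,
        ENNReal.ofReal (1 / (m + 1 + s) ^ 2) * g (1 / (m + 1 + s)) := by
  have hanti : Antitone fun n : ℕ => 1 / ((n : ℝ) + 1) := fun i j hij => by
    have : (i : ℝ) ≤ j := by exact_mod_cast hij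
    dsimp only
    gcongr
  have hU : Ioc (0 : ℝ) 1 = ⋃ n : ℕ, Ioc (1 / (((n + 1 : ℕ) : ℝ) + 1)) (1 / ((n : ℝ) + 1)) := by
    ext x
    simp only [mem_iUnion, mem_Ioc]
    constructor
    · rintro ⟨h0, h1⟩
      have hx : 1 ≤ 1 / x := by rw [le_div_iff₀ h0]; linarith
      obtain ⟨n, hn⟩ : ∃ n : ℕ, ⌊1 / x⌋₊ = n + 1 :=
        Nat.exists_eq_succ_of_ne_zero (Nat.floor_pos.2 hx).ne'
      have h2 := Nat.floor_le (zero_le_one.trans hx)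
      have h3 := Nat.lt_floor_add_one (1 / x)
      rw [hn] at h2 h3
      push_cast at h2 h3 ⊢
      refine ⟨n, ?_, ?_⟩
      · rw [div_lt_iff₀ (by positivity)]
        rw [div_lt_iff₀ h0] at h3
        linarith
      · rw [le_div_iff₀ (by positivity)]
        rw [le_div_iff₀ h0] at h2
        linarith
    · rintro ⟨n, h1, h2⟩
      refine ⟨lt_of_le_of_lt (by positivity) h1, h2.trans ?_⟩
      rw [div_le_one (by positivity)]
      linarith [Nat.cast_nonneg (α := ℝ) n]
  have hd : Pairwise (Function.onFun Disjoint fun n : ℕ =>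
      Ioc (1 / (((n + 1 : ℕ) : ℝ) + 1)) (1 / ((n : ℝ) + 1))) := by
    simpa using hanti.pairwise_disjoint_on_Ioc_succ
  conv_lhs =>
    rw [restrict_Ioo_eq_restrict_Ioc, hU, lintegral_iUnion (fun _ => measurableSet_Ioc) hd]
  refine tsum_congr fun m => ?_
  have himg : (fun s : ℝ => 1 / ((m : ℝ) + 1 + s)) '' Ioo 0 1 =
      Ioo (1 / (((m + 1 : ℕ) : ℝ) + 1)) (1 / ((m : ℝ) + 1)) := by
    ext x
    push_cast
    constructor
    · rintro ⟨s, ⟨h0, h1⟩, rfl⟩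
      constructor <;> exact one_div_lt_one_div_of_lt (by positivity) (by linarith)
    · rintro ⟨h1, h2⟩
      have hx : 0 < x := lt_of_le_of_lt (by positivity) h1
      refine ⟨1 / x - (m + 1), ⟨?_, ?_⟩, by simp⟩
      · rw [lt_div_iff₀ (by positivity)] at h2
        rw [sub_pos, lt_div_iff₀ hx]
        linarith
      · rw [div_lt_iff₀ (by positivity)] at h1
        rw [sub_lt_iff_lt_add, div_lt_iff₀ hx]
        linarith
  rw [← restrict_Ioo_eq_restrict_Ioc, ← himg,
    lintegral_image_eq_lintegral_abs_deriv_mul (f' := fun s => -(1 / ((m : ℝ) + 1 + s) ^ 2))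
      measurableSet_Ioo]
  · refine setLIntegral_congr_fun measurableSet_Ioo fun s hs => ?_
    have : 0 ≤ 1 / ((m : ℝ) + 1 + s) ^ 2 := by positivity
    simp only [abs_neg, abs_of_nonneg this]
  · intro s hs
    have hne : (m : ℝ) + 1 + s ≠ 0 := by have := hs.1; positivity
    have h := ((hasDerivAt_id s).const_add ((m : ℝ) + 1)).inv hne
    simp only [one_div]
    convert! h.hasDerivWithinAt using 1
    simp [neg_div]
  · intro s _ s' _ h
    have : (m : ℝ) + 1 + s = m + 1 + s' := by simpa using h
    linarith

/-- Decomposition of the fibre `(0,1)` over `ρ = 1/(m+1+σ)` into the `m+1` branches that fill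
`(0,1)` and the branch that fills `(-1,0)`. -/
lemma lintegral_fiber_branches (m : ℕ) {s : ℝ} (hs : 0 < s) (F : ℝ → ENNReal) :
    ∫⁻ α in Ioo (0 : ℝ) 1, F α =
      (∑ k ∈ Finset.range (m + 1), ∫⁻ β in Ioo (0 : ℝ) 1,
        ENNReal.ofReal (1 / (m + 1 + s)) * F (1 - (k + β) / (m + 1 + s))) +
      ∫⁻ β in Ioo (-1 : ℝ) 0,
        ENNReal.ofReal (s / (m + 1 + s)) * F (-(s * β) / (m + 1 + s)) := by
  have hy : (0 : ℝ) < m + 1 + s := by positivity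
  set r : ℝ := 1 / (m + 1 + s) with hr
  have hr0 : 0 < r := by positivity
  have hry : r * (m + 1 + s) = 1 := by rw [hr]; field_simp
  have htop : ∀ n : ℕ, ∫⁻ α in Ioo (1 - r * n) 1, F α =
      ∑ k ∈ Finset.range n, ∫⁻ β in Ioo (0 : ℝ) 1,
        ENNReal.ofReal r * F (1 - (k + β) / (m + 1 + s)) := by
    intro n
    induction n with
    | zero => simp
    | succ n ih =>
      rw [Finset.sum_range_succ, ← ih, lintegral_Ioo_add_Ioo (b := 1 - r * n)
        (by push_cast; nlinarith) (by nlinarith [mul_nonneg hr0.le (Nat.cast_nonneg (α := ℝ) n)]),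
        add_comm]
      congr 1
      have h := lintegral_Ioo_affine hr0 (1 - r * n) 0 1 F
      have e1 : 1 - r * n - r * 1 = 1 - r * ((n + 1 : ℕ) : ℝ) := by push_cast; ring
      rw [e1, mul_zero, sub_zero] at h
      rw [h]
      refine lintegral_congr fun β => ?_
      congr 2
      rw [hr]; ring
  rw [lintegral_Ioo_add_Ioo (b := 1 - r * ((m + 1 : ℕ) : ℝ)) (by push_cast; nlinarith)
    (by nlinarith [mul_nonneg hr0.le (Nat.cast_nonneg (α := ℝ) (m + 1))]), htop, add_comm]
  congr 1
  have h := lintegral_Ioo_affine (mul_pos hr0 hs) 0 (-1) 0 F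
  have e1 : (0 : ℝ) - r * s * (-1) = 1 - r * ((m + 1 : ℕ) : ℝ) := by push_cast; linarith
  rw [e1, mul_zero, sub_zero] at h
  rw [h]
  refine lintegral_congr fun β => ?_
  congr 2
  · rw [hr]; ring
  · rw [hr]; ring

/-! ### The squares and the inverse branches -/

/-- The open upper half of the rectangle. -/
def upperSq : Set (ℝ × ℝ) := Ioo (0 : ℝ) 1 ×ˢ Ioo (0 : ℝ) 1

/-- The open lower half of the rectangle. -/
def lowerSq : Set (ℝ × ℝ) := Ioo (0 : ℝ) 1 ×ˢ Ioo (-1 : ℝ) 0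

/-- Inverse branch of `skewProd` from the upper to the lower half. -/
def flipBranch (n : ℕ) (p : ℝ × ℝ) : ℝ × ℝ := (1 / (n + 1 + p.1), -p.2)

/-- Inverse branch of `skewProd` from the upper half to itself. -/
def stayBranch (m k : ℕ) (p : ℝ × ℝ) : ℝ × ℝ :=
  (1 / (m + 1 + p.1), 1 - (k + p.2) / (m + 1 + p.1))

/-- Inverse branch of `skewProd` from the lower to the upper half. -/
def dropBranch (m : ℕ) (p : ℝ × ℝ) : ℝ × ℝ :=
  (1 / (m + 1 + p.1), -(p.1 * p.2) / (m + 1 + p.1))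

lemma measurableSet_upperSq : MeasurableSet upperSq := measurableSet_Ioo.prod measurableSet_Ioo

lemma measurableSet_lowerSq : MeasurableSet lowerSq := measurableSet_Ioo.prod measurableSet_Ioo

@[fun_prop]
lemma measurable_flipBranch (n : ℕ) : Measurable (flipBranch n) := by
  unfold flipBranch; fun_prop

@[fun_prop]
lemma measurable_stayBranch (m k : ℕ) : Measurable (stayBranch m k) := by
  unfold stayBranch; fun_prop

@[fun_prop]
lemma measurable_dropBranch (m : ℕ) : Measurable (dropBranch m) := by
  unfold dropBranch; fun_prop

lemma lintegral_rect {s t : Set ℝ} {φ : ℝ × ℝ → ENNReal} (hφ : Measurable φ) :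
    ∫⁻ p in s ×ˢ t, φ p = ∫⁻ x in s, ∫⁻ y in t, φ (x, y) := by
  rw [Measure.volume_eq_prod, ← Measure.prod_restrict, lintegral_prod _ hφ.aemeasurable]

lemma lintegral_lowerSq {φ : ℝ × ℝ → ENNReal} (hφ : Measurable φ) :
    ∫⁻ p in lowerSq, φ p =
      ∑' n : ℕ, ∫⁻ p in upperSq, ENNReal.ofReal (1 / (n + 1 + p.1) ^ 2) * φ (flipBranch n p) := by
  unfold lowerSq upperSq
  rw [lintegral_rect hφ, lintegral_gauss_branches]
  refine tsum_congr fun n => ?_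
  rw [lintegral_rect (by fun_prop)]
  refine lintegral_congr fun s => ?_
  dsimp only
  rw [lintegral_const_mul _ (by fun_prop)]
  congr 1
  have h := lintegral_Ioo_affine one_pos 0 0 1 fun y => φ (1 / ((n : ℝ) + 1 + s), y)
  simpa [flipBranch] using h

lemma lintegral_upperSq {φ : ℝ × ℝ → ENNReal} (hφ : Measurable φ) :
    ∫⁻ p in upperSq, φ p =
      (∑' m : ℕ, ∑ k ∈ Finset.range (m + 1), ∫⁻ p in upperSq,
        ENNReal.ofReal (1 / (m + 1 + p.1) ^ 3) * φ (stayBranch m k p)) +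
      ∑' m : ℕ, ∫⁻ p in lowerSq,
        ENNReal.ofReal (p.1 / (m + 1 + p.1) ^ 3) * φ (dropBranch m p) := by
  unfold lowerSq upperSq
  rw [lintegral_rect hφ, lintegral_gauss_branches, ← ENNReal.tsum_add]
  refine tsum_congr fun m => ?_
  rw [lintegral_rect (by fun_prop)]
  simp_rw [fun k => lintegral_rect (s := Ioo (0 : ℝ) 1) (t := Ioo (0 : ℝ) 1)
    (φ := fun p => ENNReal.ofReal (1 / (m + 1 + p.1) ^ 3) * φ (stayBranch m k p)) (by fun_prop)]
  rw [← lintegral_finsetSum' _ fun k _ => Measurable.aemeasurable (by fun_prop),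
    ← lintegral_add_left (by fun_prop)]
  refine setLIntegral_congr_fun measurableSet_Ioo fun s hs => ?_
  have hs0 : 0 < s := hs.1
  have hy : (0 : ℝ) < m + 1 + s := by positivity
  rw [lintegral_fiber_branches m hs0, mul_add, Finset.mul_sum]
  congr 1
  · refine Finset.sum_congr rfl fun k _ => ?_
    rw [← lintegral_const_mul _ (by fun_prop)]
    refine lintegral_congr fun β => ?_
    rw [← mul_assoc, ← ENNReal.ofReal_mul (by positivity)]
    congr 2
    field_simp
  · rw [← lintegral_const_mul _ (by fun_prop)]
    refine lintegral_congr fun β => ?_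
    rw [← mul_assoc, ← ENNReal.ofReal_mul (by positivity)]
    congr 2
    field_simp

/-! ### `skewProd` along the inverse branches -/

lemma gaussMap_one_div (m : ℕ) {s : ℝ} (hs : s ∈ Ioo (0 : ℝ) 1) :
    gaussMap (1 / (m + 1 + s)) = s := by
  have h0 : 0 < s := hs.1
  have hne : 1 / ((m : ℝ) + 1 + s) ≠ 0 := by positivity
  rw [gaussMap, if_neg hne, one_div_one_div, add_comm, ← Nat.cast_succ, Int.fract_add_natCast,
    Int.fract_eq_self.2 ⟨h0.le, hs.2⟩]

lemma skewProd_flipBranch (n : ℕ) {p : ℝ × ℝ} (hp : p ∈ upperSq) :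
    skewProd (flipBranch n p) = p := by
  obtain ⟨s, b⟩ := p
  obtain ⟨hs, hb⟩ := hp
  have h0 : 0 < s := hs.1
  have hb0 : 0 < b := hb.1
  have hne : 1 / ((n : ℝ) + 1 + s) ≠ 0 := by positivity
  simp only [skewProd, flipBranch, fiberMap, gaussMap_one_div n hs, if_neg hne]
  rw [if_pos (by linarith), neg_neg]

lemma skewProd_stayBranch {m k : ℕ} (hk : k < m + 1) {p : ℝ × ℝ} (hp : p ∈ upperSq) :
    skewProd (stayBranch m k p) = p := by
  obtain ⟨s, b⟩ := p
  obtain ⟨hs, hb⟩ := hp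
  have h0 : 0 < s := hs.1
  have hb0 : 0 < b := hb.1
  have hb1 : b < 1 := hb.2
  have hy : (0 : ℝ) < m + 1 + s := by positivity
  have hne : 1 / ((m : ℝ) + 1 + s) ≠ 0 := by positivity
  have hk' : (k : ℝ) ≤ m := by exact_mod_cast Nat.lt_succ_iff.1 hk
  have h1 : 1 / ((m : ℝ) + 1 + s) * s < 1 - (k + b) / (m + 1 + s) := by
    rw [one_div_mul_eq_div, lt_sub_iff_add_lt, ← add_div, div_lt_one hy]
    linarith
  have h2 : 0 < 1 - (k + b) / (m + 1 + s) := lt_trans (by positivity) h1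
  simp only [skewProd, stayBranch, fiberMap, gaussMap_one_div m hs, if_neg hne,
    if_neg (not_le.2 h1), if_neg (not_le.2 h2)]
  have h3 : (1 - (1 - (k + b) / (m + 1 + s))) / (1 / ((m : ℝ) + 1 + s)) = b + k := by
    field_simp
    ring
  rw [h3, Int.fract_add_natCast, Int.fract_eq_self.2 ⟨hb0.le, hb1⟩]

lemma skewProd_dropBranch (m : ℕ) {p : ℝ × ℝ} (hp : p ∈ lowerSq) :
    skewProd (dropBranch m p) = p := by
  obtain ⟨s, b⟩ := p
  obtain ⟨hs, hb⟩ := hp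
  have h0 : 0 < s := hs.1
  have hb0 : b < 0 := hb.2
  have hb1 : -1 < b := hb.1
  have hy : (0 : ℝ) < m + 1 + s := by positivity
  have hne : 1 / ((m : ℝ) + 1 + s) ≠ 0 := by positivity
  have h1 : -(s * b) / ((m : ℝ) + 1 + s) ≤ 1 / (m + 1 + s) * s := by
    rw [one_div_mul_eq_div]
    gcongr
    nlinarith
  have h2 : 0 < -(s * b) / ((m : ℝ) + 1 + s) := div_pos (by nlinarith) hy
  simp only [skewProd, dropBranch, fiberMap, gaussMap_one_div m hs, if_neg hne,
    if_pos h1, if_neg (not_le.2 h2)]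
  congr 1
  field_simp

@[fun_prop]
lemma measurable_gaussMap : Measurable gaussMap := by
  unfold gaussMap
  exact Measurable.ite (measurableSet_singleton 0) measurable_const (by fun_prop)

@[fun_prop]
lemma measurable_skewProd : Measurable skewProd := by
  unfold skewProd fiberMap
  refine Measurable.prodMk (by fun_prop) ?_
  refine Measurable.ite (measurable_fst (measurableSet_singleton 0)) measurable_const ?_
  refine Measurable.ite (measurableSet_le (by fun_prop) (by fun_prop)) (by fun_prop) ?_
  exact Measurable.ite (measurableSet_le (by fun_prop) (by fun_prop)) (by fun_prop) (by fun_prop)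

/-! ### The invariant density -/

/-- Unnormalised invariant density on the upper half. -/
def upperDensity (r : ℝ) : ℝ := (2 + r) / (2 * (1 + r) ^ 2)

/-- Unnormalised invariant density on the lower half. -/
def lowerDensity (r : ℝ) : ℝ := r / (2 * (1 + r) ^ 2)

@[fun_prop]
lemma measurable_upperDensity : Measurable upperDensity := by unfold upperDensity; fun_prop

@[fun_prop]
lemma measurable_lowerDensity : Measurable lowerDensity := by unfold lowerDensity; fun_prop

lemma upperDensity_pos {r : ℝ} (hr : 0 < r) : 0 < upperDensity r := by
  unfold upperDensity; positivity

lemma lowerDensity_pos {r : ℝ} (hr : 0 < r) : 0 < lowerDensity r := by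
  unfold lowerDensity; positivity

lemma tendsto_one_div_natCast_add (c : ℝ) :
    Tendsto (fun n : ℕ => 1 / ((n : ℝ) + c)) atTop (𝓝 0) := by
  simp only [one_div]
  exact tendsto_inv_atTop_zero.comp (tendsto_atTop_add_const_right _ _ tendsto_natCast_atTop_atTop)

lemma hasSum_telescope {u : ℕ → ℝ} (hu : Antitone u) (h0 : Tendsto u atTop (𝓝 0)) :
    HasSum (fun n => u n - u (n + 1)) (u 0) := by
  rw [hasSum_iff_tendsto_nat_of_nonneg fun n => sub_nonneg.2 (hu n.le_succ)]
  simp only [Finset.sum_range_sub']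
  simpa using h0.const_sub (u 0)

lemma antitone_one_div_natCast_add {c : ℝ} (hc : 0 < c) :
    Antitone fun n : ℕ => 1 / ((n : ℝ) + c) := fun i j hij => by
  have : (i : ℝ) ≤ j := by exact_mod_cast hij
  dsimp only
  gcongr

lemma hasSum_upperDensity_cube {s : ℝ} (hs : 0 < s) :
    HasSum (fun m : ℕ => upperDensity (1 / (m + 1 + s)) / (m + 1 + s) ^ 3)
      (1 / (2 * (1 + s) ^ 2)) := by
  have hc : 0 < 1 + s := by positivity
  have h := (hasSum_telescope (u := fun n : ℕ => (1 / ((n : ℝ) + (1 + s))) ^ 2)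
    (fun i j hij => pow_le_pow_left₀ (by positivity) (antitone_one_div_natCast_add hc hij) 2)
    (by simpa using (tendsto_one_div_natCast_add (1 + s)).pow 2)).div_const 2
  convert! h using 1
  · funext m
    have : (0 : ℝ) < m + 1 + s := by positivity
    have : (0 : ℝ) < m + 1 + s + 1 := by positivity
    have e : (m : ℝ) + (1 + s) = m + 1 + s := by ring
    have e' : ((m + 1 : ℕ) : ℝ) + (1 + s) = m + 1 + s + 1 := by push_cast; ring
    rw [e, e', upperDensity]
    generalize (m : ℝ) + 1 + s = y at *
    field_simp
    ring
  · simp; field_simp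

/-- The transfer operator equation on the lower half. -/
lemma hasSum_lowerDensity {s : ℝ} (hs : 0 < s) :
    HasSum (fun m : ℕ => s / (m + 1 + s) ^ 3 * upperDensity (1 / (m + 1 + s)))
      (lowerDensity s) := by
  convert! (hasSum_upperDensity_cube hs).mul_left s using 1
  · funext m; ring
  · rw [lowerDensity]; ring

/-- The transfer operator equation on the upper half. -/
lemma hasSum_upperDensity {s : ℝ} (hs : 0 < s) :
    HasSum (fun m : ℕ => 1 / (m + 1 + s) ^ 2 * lowerDensity (1 / (m + 1 + s)) +
      (m + 1) * (1 / (m + 1 + s) ^ 3 * upperDensity (1 / (m + 1 + s)))) (upperDensity s) := by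
  have hc : 0 < 1 + s := by positivity
  have h := (hasSum_telescope (antitone_one_div_natCast_add hc)
    (tendsto_one_div_natCast_add (1 + s))).sub (hasSum_lowerDensity hs)
  convert! h using 1
  · funext m
    have : (0 : ℝ) < m + 1 + s := by positivity
    have : (0 : ℝ) < m + 1 + s + 1 := by positivity
    have e : (m : ℝ) + (1 + s) = m + 1 + s := by ring
    have e' : ((m + 1 : ℕ) : ℝ) + (1 + s) = m + 1 + s + 1 := by push_cast; ring
    have e'' : (m : ℝ) + 1 = (m + 1 + s) - s := by ring
    rw [e, e', e'', upperDensity, lowerDensity]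
    simp only [sub_add_cancel]
    generalize (m : ℝ) + 1 + s = y at *
    field_simp
    ring
  · rw [upperDensity, lowerDensity]; simp; field_simp; ring

/-- The unnormalised invariant measure. -/
def skewMeasure : Measure (ℝ × ℝ) :=
  (volume.restrict upperSq).withDensity (fun p => ENNReal.ofReal (upperDensity p.1)) +
    (volume.restrict lowerSq).withDensity (fun p => ENNReal.ofReal (lowerDensity p.1))

lemma lintegral_skewMeasure {φ : ℝ × ℝ → ENNReal} (hφ : Measurable φ) :
    ∫⁻ p, φ p ∂skewMeasure = (∫⁻ p in upperSq, ENNReal.ofReal (upperDensity p.1) * φ p) +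
      ∫⁻ p in lowerSq, ENNReal.ofReal (lowerDensity p.1) * φ p := by
  rw [skewMeasure, lintegral_add_measure,
    lintegral_withDensity_eq_lintegral_mul _ (by fun_prop) hφ,
    lintegral_withDensity_eq_lintegral_mul _ (by fun_prop) hφ]
  rfl

lemma map_skewProd_skewMeasure : skewMeasure.map skewProd = skewMeasure := by
  refine Measure.ext_of_lintegral _ fun φ hφ => ?_
  rw [lintegral_map hφ measurable_skewProd,
    lintegral_skewMeasure (φ := fun p => φ (skewProd p)) (by fun_prop), lintegral_skewMeasure hφ,
    lintegral_lowerSq (by fun_prop), lintegral_upperSq (by fun_prop)]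
  have hflip : ∀ n : ℕ, ∫⁻ p in upperSq, ENNReal.ofReal (1 / (n + 1 + p.1) ^ 2) *
      (ENNReal.ofReal (lowerDensity (flipBranch n p).1) * φ (skewProd (flipBranch n p))) =
      ∫⁻ p in upperSq, ENNReal.ofReal
        (1 / (n + 1 + p.1) ^ 2 * lowerDensity (1 / (n + 1 + p.1))) * φ p := by
    intro n
    refine setLIntegral_congr_fun measurableSet_upperSq fun p hp => ?_
    rw [skewProd_flipBranch n hp, ← mul_assoc, ← ENNReal.ofReal_mul (by positivity)]
    rfl
  have hstay : ∀ m : ℕ, ∑ k ∈ Finset.range (m + 1), ∫⁻ p in upperSq,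
      ENNReal.ofReal (1 / (m + 1 + p.1) ^ 3) * (ENNReal.ofReal (upperDensity (stayBranch m k p).1) *
        φ (skewProd (stayBranch m k p))) =
      ∫⁻ p in upperSq, ENNReal.ofReal
        ((m + 1) * (1 / (m + 1 + p.1) ^ 3 * upperDensity (1 / (m + 1 + p.1)))) * φ p := by
    intro m
    have : ∀ k ∈ Finset.range (m + 1), ∫⁻ p in upperSq,
      ENNReal.ofReal (1 / (m + 1 + p.1) ^ 3) * (ENNReal.ofReal (upperDensity (stayBranch m k p).1) *
        φ (skewProd (stayBranch m k p))) = ∫⁻ p in upperSq, ENNReal.ofReal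
        (1 / (m + 1 + p.1) ^ 3 * upperDensity (1 / (m + 1 + p.1))) * φ p := by
      intro k hk
      refine setLIntegral_congr_fun measurableSet_upperSq fun p hp => ?_
      have hp0 : 0 < p.1 := hp.1.1
      rw [skewProd_stayBranch (Finset.mem_range.1 hk) hp, ← mul_assoc,
        ← ENNReal.ofReal_mul (by positivity)]
      rfl
    rw [Finset.sum_congr rfl this, Finset.sum_const, Finset.card_range, nsmul_eq_mul,
      ← lintegral_const_mul _ (by fun_prop)]
    refine lintegral_congr fun p => ?_
    have hm : (m : ℝ) + 1 = ((m + 1 : ℕ) : ℝ) := by push_cast; rfl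
    rw [ENNReal.ofReal_mul (p := (m : ℝ) + 1) (by positivity), hm, ENNReal.ofReal_natCast, mul_assoc]
  have hdrop : ∀ m : ℕ, ∫⁻ p in lowerSq, ENNReal.ofReal (p.1 / (m + 1 + p.1) ^ 3) *
      (ENNReal.ofReal (upperDensity (dropBranch m p).1) * φ (skewProd (dropBranch m p))) =
      ∫⁻ p in lowerSq, ENNReal.ofReal
        (p.1 / (m + 1 + p.1) ^ 3 * upperDensity (1 / (m + 1 + p.1))) * φ p := by
    intro m
    refine setLIntegral_congr_fun measurableSet_lowerSq fun p hp => ?_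
    have hp0 : 0 < p.1 := hp.1.1
    rw [skewProd_dropBranch m hp, ← mul_assoc, ← ENNReal.ofReal_mul (by positivity)]
    rfl
  simp only [hflip, hstay, hdrop]
  rw [add_right_comm]
  congr 1
  · rw [← lintegral_tsum fun m => Measurable.aemeasurable (by fun_prop),
      ← lintegral_tsum fun m => Measurable.aemeasurable (by fun_prop),
      ← lintegral_add_left (Measurable.tsum fun m => by fun_prop)]
    refine setLIntegral_congr_fun measurableSet_upperSq fun p hp => ?_
    have hp0 : 0 < p.1 := hp.1.1
    have hl (m : ℕ) : 0 ≤ 1 / (m + 1 + p.1) ^ 2 * lowerDensity (1 / (m + 1 + p.1)) := by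
      have := lowerDensity_pos (r := 1 / (m + 1 + p.1)) (by positivity)
      positivity
    have hu (m : ℕ) :
        0 ≤ (m + 1) * (1 / (m + 1 + p.1) ^ 3 * upperDensity (1 / (m + 1 + p.1))) := by
      have := upperDensity_pos (r := 1 / (m + 1 + p.1)) (by positivity)
      positivity
    simp only [ENNReal.tsum_mul_right]
    rw [← add_mul, add_comm, ← ENNReal.tsum_add, ← (hasSum_upperDensity hp0).tsum_eq,
      ENNReal.ofReal_tsum_of_nonneg (fun m => add_nonneg (hl m) (hu m))
        (hasSum_upperDensity hp0).summable]
    simp only [ENNReal.ofReal_add (hl _) (hu _)]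
  · rw [← lintegral_tsum fun m => Measurable.aemeasurable (by fun_prop)]
    refine setLIntegral_congr_fun measurableSet_lowerSq fun p hp => ?_
    have hp0 : 0 < p.1 := hp.1.1
    rw [ENNReal.tsum_mul_right, ← (hasSum_lowerDensity hp0).tsum_eq,
      ENNReal.ofReal_tsum_of_nonneg _ (hasSum_lowerDensity hp0).summable]
    intro m
    have := upperDensity_pos (r := 1 / (m + 1 + p.1)) (by positivity)
    positivity

/-! ### Inverse branches of the first return map to the upper half -/

/-- A distance on the upper half, in projective coordinates, which is contracted by the inverse
branches of the first return map. -/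
def projDist (p q : ℝ × ℝ) : ℝ :=
  3 * |1 / (1 + p.1) - 1 / (1 + q.1)| + |p.2 / (1 + p.1) - q.2 / (1 + q.1)|

lemma dist_le_projDist {p q : ℝ × ℝ} (hp : p ∈ upperSq) (hq : q ∈ upperSq) :
    dist p q ≤ 2 * projDist p q := by
  obtain ⟨s, b⟩ := p
  obtain ⟨s', b'⟩ := q
  obtain ⟨⟨hs0, hs1⟩, hb0, hb1⟩ := hp
  obtain ⟨⟨hs0', hs1'⟩, hb0', hb1'⟩ := hq
  dsimp only at *
  have e1 : s - s' = -((1 + s) * (1 + s') * (1 / (1 + s) - 1 / (1 + s'))) := by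
    field_simp
    ring
  have e2 : b - b' = (1 + s) * (b / (1 + s) - b' / (1 + s')) + b' / (1 + s') * (s - s') := by
    field_simp
    ring
  have h1 : |s - s'| ≤ 4 * |1 / (1 + s) - 1 / (1 + s')| := by
    rw [e1, abs_neg, abs_mul, abs_of_pos (a := (1 + s) * (1 + s')) (by positivity)]
    gcongr
    nlinarith
  have h3 : b' / (1 + s') ≤ 1 := by
    rw [div_le_one (by positivity)]
    linarith
  have h2 : |b - b'| ≤ 2 * |b / (1 + s) - b' / (1 + s')| + |s - s'| := by
    rw [e2]
    refine (abs_add_le _ _).trans ?_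
    rw [abs_mul, abs_mul, abs_of_pos (a := 1 + s) (by positivity),
      abs_of_pos (a := b' / (1 + s')) (by positivity)]
    have := mul_le_mul_of_nonneg_right h3 (abs_nonneg (s - s'))
    have := mul_le_mul_of_nonneg_right (show 1 + s ≤ 2 by linarith)
      (abs_nonneg (b / (1 + s) - b' / (1 + s')))
    linarith
  have := abs_nonneg (1 / (1 + s) - 1 / (1 + s'))
  have := abs_nonneg (b / (1 + s) - b' / (1 + s'))
  rw [Prod.dist_eq, Real.dist_eq, Real.dist_eq, projDist]
  dsimp only
  exact max_le (by linarith) (by linarith)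

lemma projDist_le_four {p q : ℝ × ℝ} (hp : p ∈ upperSq) (hq : q ∈ upperSq) : projDist p q ≤ 4 := by
  obtain ⟨s, b⟩ := p
  obtain ⟨s', b'⟩ := q
  obtain ⟨⟨hs0, hs1⟩, hb0, hb1⟩ := hp
  obtain ⟨⟨hs0', hs1'⟩, hb0', hb1'⟩ := hq
  dsimp only at *
  have h1 : 1 / (1 + s) ≤ 1 := by rw [div_le_one (by positivity)]; linarith
  have h1' : 1 / (1 + s') ≤ 1 := by rw [div_le_one (by positivity)]; linarith
  have h2 : b / (1 + s) ≤ 1 := by rw [div_le_one (by positivity)]; linarith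
  have h2' : b' / (1 + s') ≤ 1 := by rw [div_le_one (by positivity)]; linarith
  have h3 : 0 < 1 / (1 + s) := by positivity
  have h3' : 0 < 1 / (1 + s') := by positivity
  have h4 : 0 < b / (1 + s) := by positivity
  have h4' : 0 < b' / (1 + s') := by positivity
  have h5 : |1 / (1 + s) - 1 / (1 + s')| ≤ 1 := abs_le.2 ⟨by linarith, by linarith⟩
  have h6 : |b / (1 + s) - b' / (1 + s')| ≤ 1 := abs_le.2 ⟨by linarith, by linarith⟩
  rw [projDist]
  dsimp only
  linarith

lemma projCoord_mem {p : ℝ × ℝ} (hp : p ∈ upperSq) :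
    1 / 2 ≤ 1 / (1 + p.1) ∧ 0 < p.2 / (1 + p.1) ∧ p.2 / (1 + p.1) ≤ 1 := by
  obtain ⟨⟨hs0, hs1⟩, hb0, hb1⟩ := hp
  refine ⟨?_, by positivity, ?_⟩
  · exact one_div_le_one_div_of_le (by positivity) (by linarith)
  · rw [div_le_one (by positivity)]
    linarith

/-- Inverse branch of the first return map to the upper half that passes through the lower half. -/
def throughBranch (m n : ℕ) (p : ℝ × ℝ) : ℝ × ℝ := dropBranch m (flipBranch n p)

lemma throughBranch_fst (m n : ℕ) {p : ℝ × ℝ} (hp : p ∈ upperSq) :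
    (throughBranch m n p).1 = (p.1 + (n + 1)) / ((m + 1) * p.1 + ((m + 1) * (n + 1) + 1)) := by
  have h0 : 0 < p.1 := hp.1.1
  simp only [throughBranch, dropBranch, flipBranch]
  field_simp
  ring

lemma throughBranch_snd (m n : ℕ) {p : ℝ × ℝ} (hp : p ∈ upperSq) :
    (throughBranch m n p).2 = p.2 / ((m + 1) * p.1 + ((m + 1) * (n + 1) + 1)) := by
  have h0 : 0 < p.1 := hp.1.1
  simp only [throughBranch, dropBranch, flipBranch]
  field_simp
  ring

lemma projDist_stayBranch_le {m k : ℕ} (hk : k < m + 1) {p q : ℝ × ℝ} (hp : p ∈ upperSq)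
    (hq : q ∈ upperSq) :
    projDist (stayBranch m k p) (stayBranch m k q) ≤ 2 / 3 * projDist p q := by
  have coord : ∀ {p : ℝ × ℝ}, p ∈ upperSq →
      1 / (1 + (stayBranch m k p).1) = 1 - 1 / (1 + p.1) / (1 + (m + 1) * (1 / (1 + p.1))) ∧
      (stayBranch m k p).2 / (1 + (stayBranch m k p).1) =
        1 - ((k + 1) * (1 / (1 + p.1)) + p.2 / (1 + p.1)) / (1 + (m + 1) * (1 / (1 + p.1))) := by
    intro p hp
    have h0 : 0 < p.1 := hp.1.1
    simp only [stayBranch]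
    constructor
    · field_simp
      ring
    · field_simp
      ring
  obtain ⟨hS, ht0, ht1⟩ := projCoord_mem hp
  obtain ⟨hS', ht0', ht1'⟩ := projCoord_mem hq
  rw [projDist, projDist, (coord hp).1, (coord hp).2, (coord hq).1, (coord hq).2]
  generalize 1 / (1 + p.1) = S at *
  generalize p.2 / (1 + p.1) = t at *
  generalize 1 / (1 + q.1) = S' at *
  generalize q.2 / (1 + q.1) = t' at *
  have hk' : (k : ℝ) + 1 ≤ m + 1 := by exact_mod_cast hk
  have hk0 : (0 : ℝ) ≤ k := Nat.cast_nonneg k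
  have hM : (1 : ℝ) ≤ m + 1 := by linarith [Nat.cast_nonneg (α := ℝ) m]
  generalize (m : ℝ) + 1 = M at *
  have hE : 3 / 2 ≤ 1 + M * S := by nlinarith
  have hE' : 3 / 2 ≤ 1 + M * S' := by nlinarith
  have hE0 : 0 < 1 + M * S := by linarith
  have hE0' : 0 < 1 + M * S' := by linarith
  have e1 : 1 - S / (1 + M * S) - (1 - S' / (1 + M * S')) =
      -(1 / ((1 + M * S) * (1 + M * S')) * (S - S')) := by
    field_simp
    ring
  have e2 : 1 - ((k + 1) * S + t) / (1 + M * S) - (1 - ((k + 1) * S' + t') / (1 + M * S')) =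
      -((k + 1 - M * t') / ((1 + M * S) * (1 + M * S')) * (S - S') +
        1 / (1 + M * S) * (t - t')) := by
    field_simp
    ring
  have b1 : 1 / ((1 + M * S) * (1 + M * S')) ≤ 4 / 9 := by
    rw [div_le_div_iff₀ (by positivity) (by positivity)]
    nlinarith
  have b2 : |(k + 1 - M * t') / ((1 + M * S) * (1 + M * S'))| ≤ 1 / 2 := by
    have hM2 : M / ((1 + M * S) * (1 + M * S')) ≤ 1 / 2 := by
      rw [div_le_div_iff₀ (by positivity) (by positivity)]
      have h1 : 1 + M / 2 ≤ 1 + M * S := by nlinarith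
      have h2 : 1 + M / 2 ≤ 1 + M * S' := by nlinarith
      have h3 := mul_le_mul h1 h2 (by positivity) hE0.le
      nlinarith [sq_nonneg (1 - M / 2)]
    rw [abs_div, abs_of_pos (a := (1 + M * S) * (1 + M * S')) (by positivity)]
    refine le_trans ?_ hM2
    gcongr
    rw [abs_le]
    constructor <;> nlinarith
  have b3 : 1 / (1 + M * S) ≤ 2 / 3 := by
    rw [div_le_div_iff₀ (by positivity) (by positivity)]
    linarith
  rw [e1, e2, abs_neg, abs_neg, abs_mul, abs_of_pos (a := 1 / ((1 + M * S) * (1 + M * S')))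
    (by positivity)]
  have h := abs_add_le ((k + 1 - M * t') / ((1 + M * S) * (1 + M * S')) * (S - S'))
    (1 / (1 + M * S) * (t - t'))
  rw [abs_mul, abs_mul, abs_of_pos (a := 1 / (1 + M * S)) (by positivity)] at h
  have := mul_le_mul_of_nonneg_right b1 (abs_nonneg (S - S'))
  have := mul_le_mul_of_nonneg_right b2 (abs_nonneg (S - S'))
  have := mul_le_mul_of_nonneg_right b3 (abs_nonneg (t - t'))
  linarith [abs_nonneg (S - S'), abs_nonneg (t - t')]

lemma projDist_throughBranch_le (m n : ℕ) {p q : ℝ × ℝ} (hp : p ∈ upperSq)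
    (hq : q ∈ upperSq) :
    projDist (throughBranch m n p) (throughBranch m n q) ≤ 2 / 3 * projDist p q := by
  have coord : ∀ {p : ℝ × ℝ}, p ∈ upperSq →
      1 / (1 + (throughBranch m n p).1) = 1 - (n * (1 / (1 + p.1)) + 1) /
        ((m + 2) + ((m + 2) * n + 1) * (1 / (1 + p.1))) ∧
      (throughBranch m n p).2 / (1 + (throughBranch m n p).1) =
        p.2 / (1 + p.1) / ((m + 2) + ((m + 2) * n + 1) * (1 / (1 + p.1))) := by
    intro p hp
    have h0 : 0 < p.1 := hp.1.1
    rw [throughBranch_fst m n hp, throughBranch_snd m n hp]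
    constructor
    · field_simp
      ring
    · field_simp
      ring
  obtain ⟨hS, ht0, ht1⟩ := projCoord_mem hp
  obtain ⟨hS', ht0', ht1'⟩ := projCoord_mem hq
  rw [projDist, projDist, (coord hp).1, (coord hp).2, (coord hq).1, (coord hq).2]
  generalize 1 / (1 + p.1) = S at *
  generalize p.2 / (1 + p.1) = t at *
  generalize 1 / (1 + q.1) = S' at *
  generalize q.2 / (1 + q.1) = t' at *
  have hK : (2 : ℝ) ≤ m + 2 := by linarith [Nat.cast_nonneg (α := ℝ) m]
  have hn : (0 : ℝ) ≤ n := Nat.cast_nonneg n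
  generalize (m : ℝ) + 2 = K at *
  generalize (n : ℝ) = P at *
  obtain ⟨B, hB⟩ : ∃ B, B = K * P + 1 := ⟨_, rfl⟩
  have hB1 : 1 ≤ B := by rw [hB]; nlinarith
  rw [← hB]
  have hE : K + B / 2 ≤ K + B * S := by nlinarith
  have hE' : K + B / 2 ≤ K + B * S' := by nlinarith
  have hE0 : 0 < K + B * S := by linarith
  have hE0' : 0 < K + B * S' := by linarith
  have hEE := mul_le_mul hE hE' (by positivity) hE0.le
  have e1 : 1 - (P * S + 1) / (K + B * S) - (1 - (P * S' + 1) / (K + B * S')) =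
      1 / ((K + B * S) * (K + B * S')) * (S - S') := by
    field_simp
    rw [hB]
    ring
  have e2 : t / (K + B * S) - t' / (K + B * S') =
      1 / (K + B * S) * (t - t') - t' * (B / ((K + B * S) * (K + B * S'))) * (S - S') := by
    field_simp
    ring
  have b1 : 1 / ((K + B * S) * (K + B * S')) ≤ 4 / 9 := by
    rw [div_le_div_iff₀ (by positivity) (by positivity)]
    nlinarith
  have b2 : t' * (B / ((K + B * S) * (K + B * S'))) ≤ 1 / 2 := by
    have : B / ((K + B * S) * (K + B * S')) ≤ 1 / 2 := by
      rw [div_le_div_iff₀ (by positivity) (by positivity)]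
      nlinarith [sq_nonneg (K - B / 2)]
    have h0 : 0 ≤ B / ((K + B * S) * (K + B * S')) := by positivity
    nlinarith
  have b3 : 1 / (K + B * S) ≤ 2 / 3 := by
    rw [div_le_div_iff₀ (by positivity) (by positivity)]
    linarith
  have h := abs_sub_le (1 / (K + B * S) * (t - t')) 0
    (t' * (B / ((K + B * S) * (K + B * S'))) * (S - S'))
  rw [sub_zero, zero_sub, abs_neg, abs_mul, abs_mul, abs_of_pos (a := 1 / (K + B * S))
    (by positivity), abs_of_pos (a := t' * (B / ((K + B * S) * (K + B * S'))))
    (by positivity)] at h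
  rw [e1, e2, abs_mul, abs_of_pos (a := 1 / ((K + B * S) * (K + B * S'))) (by positivity)]
  have := mul_le_mul_of_nonneg_right b1 (abs_nonneg (S - S'))
  have := mul_le_mul_of_nonneg_right b2 (abs_nonneg (S - S'))
  have := mul_le_mul_of_nonneg_right b3 (abs_nonneg (t - t'))
  linarith [abs_nonneg (S - S'), abs_nonneg (t - t')]

/-- `V` is an inverse branch on the upper half of an `n`-th iterate of the first return map; its
first coordinate is the Möbius map with coefficients `a b c d`. -/
structure IsReturnBranch (n : ℕ) (V : ℝ × ℝ → ℝ × ℝ) (a b c d : ℝ) : Prop where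
  measurable : Measurable V
  mapsTo : MapsTo V upperSq upperSq
  fst_eq : ∀ p ∈ upperSq, (V p).1 = (a * p.1 + b) / (c * p.1 + d)
  a_nonneg : 0 ≤ a
  b_nonneg : 0 ≤ b
  c_nonneg : 0 ≤ c
  d_pos : 0 < d
  c_le_d : c ≤ d
  add_le_add : a + c ≤ b + d
  iterate_eq : ∃ j, ∀ p ∈ upperSq, skewProd^[j] (V p) = p
  projDist_le : ∀ p ∈ upperSq, ∀ q ∈ upperSq,
    projDist (V p) (V q) ≤ (2 / 3) ^ n * projDist p q

lemma isReturnBranch_id : IsReturnBranch 0 id 1 0 0 1 where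
  measurable := measurable_id
  mapsTo := mapsTo_id _
  fst_eq := by simp
  a_nonneg := zero_le_one
  b_nonneg := le_rfl
  c_nonneg := le_rfl
  d_pos := one_pos
  c_le_d := zero_le_one
  add_le_add := by simp
  iterate_eq := ⟨0, by simp⟩
  projDist_le := by simp

lemma IsReturnBranch.comp {k n : ℕ} {U V : ℝ × ℝ → ℝ × ℝ} {e f g h a b c d : ℝ}
    (hU : IsReturnBranch k U e f g h) (hV : IsReturnBranch n V a b c d) :
    IsReturnBranch (k + n) (U ∘ V)
      (e * a + f * c) (e * b + f * d) (g * a + h * c) (g * b + h * d) where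
  measurable := hU.measurable.comp hV.measurable
  mapsTo := hU.mapsTo.comp hV.mapsTo
  fst_eq p hp := by
    have hp0 : 0 < p.1 := hp.1.1
    have hD : 0 < c * p.1 + d := add_pos_of_nonneg_of_pos (mul_nonneg hV.c_nonneg hp0.le) hV.d_pos
    rw [Function.comp_apply, hU.fst_eq _ (hV.mapsTo hp), hV.fst_eq p hp,
      ← mul_div_mul_right _ _ hD.ne']
    congr 1 <;> rw [add_mul, mul_assoc, div_mul_cancel₀ _ hD.ne'] <;> ring
  a_nonneg := add_nonneg (mul_nonneg hU.a_nonneg hV.a_nonneg) (mul_nonneg hU.b_nonneg hV.c_nonneg)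
  b_nonneg := add_nonneg (mul_nonneg hU.a_nonneg hV.b_nonneg)
    (mul_nonneg hU.b_nonneg hV.d_pos.le)
  c_nonneg := add_nonneg (mul_nonneg hU.c_nonneg hV.a_nonneg)
    (mul_nonneg hU.d_pos.le hV.c_nonneg)
  d_pos := add_pos_of_nonneg_of_pos (mul_nonneg hU.c_nonneg hV.b_nonneg)
    (mul_pos hU.d_pos hV.d_pos)
  c_le_d := by
    nlinarith [mul_le_mul_of_nonneg_left hV.add_le_add hU.c_nonneg,
      mul_le_mul_of_nonneg_left hV.c_le_d (sub_nonneg.2 hU.c_le_d)]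
  add_le_add := by
    nlinarith [mul_le_mul_of_nonneg_left hV.add_le_add (add_nonneg hU.a_nonneg hU.c_nonneg),
      mul_le_mul_of_nonneg_left hV.c_le_d (sub_nonneg.2 hU.add_le_add)]
  iterate_eq := by
    obtain ⟨i, hi⟩ := hU.iterate_eq
    obtain ⟨j, hj⟩ := hV.iterate_eq
    refine ⟨j + i, fun p hp => ?_⟩
    rw [Function.iterate_add_apply, Function.comp_apply, hi _ (hV.mapsTo hp), hj p hp]
  projDist_le p hp q hq := by
    have h1 := hU.projDist_le _ (hV.mapsTo hp) _ (hV.mapsTo hq)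
    have h2 := mul_le_mul_of_nonneg_left (hV.projDist_le p hp q hq)
      (show (0 : ℝ) ≤ (2 / 3) ^ k by positivity)
    rw [pow_add, mul_assoc]
    exact h1.trans h2

lemma isReturnBranch_stayBranch {m k : ℕ} (hk : k < m + 1) :
    IsReturnBranch 1 (stayBranch m k) 0 1 1 (m + 1) where
  measurable := measurable_stayBranch m k
  mapsTo p hp := by
    obtain ⟨⟨hs0, hs1⟩, hb0, hb1⟩ := hp
    have hk' : (k : ℝ) ≤ m := by exact_mod_cast Nat.lt_succ_iff.1 hk
    have hm : (0 : ℝ) ≤ m := Nat.cast_nonneg m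
    refine ⟨⟨?_, ?_⟩, ?_, ?_⟩ <;> simp only [stayBranch]
    · positivity
    · rw [div_lt_one (by positivity)]
      linarith
    · rw [sub_pos, div_lt_one (by positivity)]
      linarith
    · have : 0 < (k + p.2) / (m + 1 + p.1) := by positivity
      linarith
  fst_eq p _ := by
    simp only [stayBranch]
    ring
  a_nonneg := le_rfl
  b_nonneg := zero_le_one
  c_nonneg := zero_le_one
  d_pos := by positivity
  c_le_d := by linarith [Nat.cast_nonneg (α := ℝ) m]
  add_le_add := by linarith [Nat.cast_nonneg (α := ℝ) m]
  iterate_eq := ⟨1, fun p hp => by simpa using skewProd_stayBranch hk hp⟩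
  projDist_le p hp q hq := by simpa using projDist_stayBranch_le hk hp hq

lemma flipBranch_mem_lowerSq (n : ℕ) {p : ℝ × ℝ} (hp : p ∈ upperSq) :
    flipBranch n p ∈ lowerSq := by
  obtain ⟨⟨hs0, hs1⟩, hb0, hb1⟩ := hp
  have hn : (0 : ℝ) ≤ n := Nat.cast_nonneg n
  refine ⟨⟨?_, ?_⟩, ?_, ?_⟩ <;> simp only [flipBranch]
  · positivity
  · rw [div_lt_one (by positivity)]
    linarith
  · linarith
  · linarith

lemma isReturnBranch_throughBranch (m n : ℕ) :
    IsReturnBranch 1 (throughBranch m n) 1 (n + 1) (m + 1) ((m + 1) * (n + 1) + 1) where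
  measurable := (measurable_dropBranch m).comp (measurable_flipBranch n)
  mapsTo p hp := by
    have h1 := throughBranch_fst m n hp
    have h2 := throughBranch_snd m n hp
    obtain ⟨⟨hs0, hs1⟩, hb0, hb1⟩ := hp
    have hm : (0 : ℝ) ≤ m := Nat.cast_nonneg m
    have hn : (0 : ℝ) ≤ n := Nat.cast_nonneg n
    refine ⟨⟨?_, ?_⟩, ?_, ?_⟩
    · rw [h1]; positivity
    · rw [h1, div_lt_one (by positivity)]
      nlinarith [mul_nonneg hm hs0.le, mul_nonneg hm hn]
    · rw [h2]; positivity
    · rw [h2, div_lt_one (by positivity)]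
      nlinarith [mul_nonneg hm hs0.le, mul_nonneg hm hn]
  fst_eq p hp := by rw [throughBranch_fst m n hp, one_mul]
  a_nonneg := zero_le_one
  b_nonneg := by positivity
  c_nonneg := by positivity
  d_pos := by positivity
  c_le_d := by nlinarith [mul_nonneg (Nat.cast_nonneg (α := ℝ) m) (Nat.cast_nonneg (α := ℝ) n)]
  add_le_add := by
    nlinarith [mul_nonneg (Nat.cast_nonneg (α := ℝ) m) (Nat.cast_nonneg (α := ℝ) n)]
  iterate_eq := ⟨2, fun p hp => by
    simp only [Function.iterate_succ, Function.iterate_zero, Function.comp_apply, id, throughBranch]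
    rw [skewProd_dropBranch m (flipBranch_mem_lowerSq n hp), skewProd_flipBranch n hp]⟩
  projDist_le p hp q hq := by simpa using projDist_throughBranch_le m n hp hq

/-- A family of return branches of order `n` whose images tile the upper half. -/
def IsReturnFamily (n : ℕ) {κ : Type} (V : κ → ℝ × ℝ → ℝ × ℝ) (a b c d : κ → ℝ) : Prop :=
  (∀ i, IsReturnBranch n (V i) (a i) (b i) (c i) (d i)) ∧
  ∀ φ : ℝ × ℝ → ENNReal, Measurable φ → ∫⁻ p in upperSq, φ p =
    ∑' i, ∫⁻ p in upperSq, ENNReal.ofReal (1 / (c i * p.1 + d i) ^ 3) * φ (V i p)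

lemma IsReturnFamily.comp {k n : ℕ} {ι κ : Type} {U : ι → ℝ × ℝ → ℝ × ℝ}
    {V : κ → ℝ × ℝ → ℝ × ℝ} {e f g h : ι → ℝ} {a b c d : κ → ℝ}
    (hU : IsReturnFamily k U e f g h) (hV : IsReturnFamily n V a b c d) :
    IsReturnFamily (k + n) (fun i : ι × κ => U i.1 ∘ V i.2)
      (fun i => e i.1 * a i.2 + f i.1 * c i.2) (fun i => e i.1 * b i.2 + f i.1 * d i.2)
      (fun i => g i.1 * a i.2 + h i.1 * c i.2) (fun i => g i.1 * b i.2 + h i.1 * d i.2) := by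
  refine ⟨fun i => (hU.1 i.1).comp (hV.1 i.2), fun φ hφ => ?_⟩
  rw [hU.2 φ hφ, ENNReal.tsum_prod']
  refine tsum_congr fun i => ?_
  have hmU := (hU.1 i).measurable
  rw [hV.2 _ (by fun_prop)]
  refine tsum_congr fun j => setLIntegral_congr_fun measurableSet_upperSq fun p hp => ?_
  have hb := hV.1 j
  have hp0 : 0 < p.1 := hp.1.1
  have hD : 0 < c j * p.1 + d j :=
    add_pos_of_nonneg_of_pos (mul_nonneg hb.c_nonneg hp0.le) hb.d_pos
  dsimp only [Function.comp_apply]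
  rw [← mul_assoc, ← ENNReal.ofReal_mul (by positivity), hb.fst_eq p hp, div_mul_div_comm, one_mul,
    ← mul_pow]
  congr 4
  field_simp
  ring

lemma exists_isReturnFamily_one :
    ∃ (κ : Type) (V : κ → ℝ × ℝ → ℝ × ℝ) (a b c d : κ → ℝ), IsReturnFamily 1 V a b c d := by
  refine ⟨(Σ m : ℕ, Fin (m + 1)) ⊕ (ℕ × ℕ),
    Sum.elim (fun i => stayBranch i.1 i.2) (fun i => throughBranch i.1 i.2),
    Sum.elim (fun _ => 0) (fun _ => 1), Sum.elim (fun _ => 1) (fun i => i.2 + 1),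
    Sum.elim (fun _ => 1) (fun i => i.1 + 1),
    Sum.elim (fun i => i.1 + 1) (fun i => (i.1 + 1) * (i.2 + 1) + 1), ?_, fun φ hφ => ?_⟩
  · rintro (⟨m, k⟩ | ⟨m, n⟩)
    · exact isReturnBranch_stayBranch k.2
    · exact isReturnBranch_throughBranch m n
  · rw [lintegral_upperSq hφ, ENNReal.summable.tsum_sum ENNReal.summable, ENNReal.tsum_sigma',
      ENNReal.tsum_prod']
    congr 1
    · refine tsum_congr fun m => ?_
      rw [tsum_fintype, Finset.sum_range]
      simp only [Sum.elim_inl, one_mul, add_comm]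
    · refine tsum_congr fun m => ?_
      rw [lintegral_lowerSq (by fun_prop)]
      refine tsum_congr fun n => setLIntegral_congr_fun measurableSet_upperSq fun p hp => ?_
      have hp0 : 0 < p.1 := hp.1.1
      simp only [Sum.elim_inr, throughBranch]
      rw [← mul_assoc, ← ENNReal.ofReal_mul (by positivity)]
      congr 2
      simp only [flipBranch]
      field_simp
      ring

lemma exists_isReturnFamily (n : ℕ) :
    ∃ (κ : Type) (V : κ → ℝ × ℝ → ℝ × ℝ) (a b c d : κ → ℝ), IsReturnFamily n V a b c d := by
  induction n with
  | zero =>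
    refine ⟨Unit, fun _ => id, fun _ => 1, fun _ => 0, fun _ => 0, fun _ => 1,
      fun _ => isReturnBranch_id, fun φ _ => ?_⟩
    simp [tsum_fintype]
  | succ n ih =>
    obtain ⟨ι, U, e, f, g, h, hU⟩ := ih
    obtain ⟨κ, V, a, b, c, d, hV⟩ := exists_isReturnFamily_one
    exact ⟨_, _, _, _, _, _, hU.comp hV⟩

/-! ### Ergodicity -/

lemma IsReturnBranch.mem_iff {n : ℕ} {V : ℝ × ℝ → ℝ × ℝ} {a b c d : ℝ}
    (hV : IsReturnBranch n V a b c d) {A : Set (ℝ × ℝ)} (hA : skewProd ⁻¹' A = A) {p : ℝ × ℝ}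
    (hp : p ∈ upperSq) : V p ∈ A ↔ p ∈ A := by
  obtain ⟨j, hj⟩ := hV.iterate_eq
  have h : skewProd^[j] ⁻¹' A = A := by
    rw [Set.preimage_iterate_eq]
    exact Function.iterate_fixed hA j
  conv_lhs => rw [← h, mem_preimage, hj p hp]

lemma IsReturnBranch.dist_le {n : ℕ} {V : ℝ × ℝ → ℝ × ℝ} {a b c d : ℝ}
    (hV : IsReturnBranch n V a b c d) {p q : ℝ × ℝ} (hp : p ∈ upperSq) (hq : q ∈ upperSq) :
    dist (V p) (V q) ≤ 8 * (2 / 3) ^ n := by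
  have h1 := dist_le_projDist (hV.mapsTo hp) (hV.mapsTo hq)
  have h2 := hV.projDist_le p hp q hq
  have h3 := mul_le_mul_of_nonneg_left (projDist_le_four hp hq)
    (show (0 : ℝ) ≤ (2 / 3) ^ n by positivity)
  linarith

lemma volume_upperSq : volume upperSq = 1 := by
  rw [upperSq, Measure.volume_eq_prod, Measure.prod_prod]
  simp

/-- Bounded distortion: the density of an invariant set in each cylinder is comparable to its
density in the whole upper half. -/
lemma IsReturnBranch.mul_lintegral_le {n : ℕ} {V : ℝ × ℝ → ℝ × ℝ} {a b c d : ℝ}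
    (hV : IsReturnBranch n V a b c d) {A K : Set (ℝ × ℝ)} (hAm : MeasurableSet A)
    (hA : skewProd ⁻¹' A = A) {δ : ℝ} (hδ : 8 * (2 / 3) ^ n < δ) :
    volume (A ∩ upperSq) * ∫⁻ p in upperSq,
        ENNReal.ofReal (1 / (c * p.1 + d) ^ 3) * K.indicator 1 (V p) ≤
      8 * ∫⁻ p in upperSq, ENNReal.ofReal (1 / (c * p.1 + d) ^ 3) *
        (A ∩ Metric.thickening δ K).indicator 1 (V p) := by
  by_cases hK : ∃ q ∈ upperSq, V q ∈ K
  · obtain ⟨q, hq, hqK⟩ := hK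
    have hc := hV.c_nonneg
    have hd := hV.d_pos
    have h1 : ∫⁻ p in upperSq, ENNReal.ofReal (1 / (c * p.1 + d) ^ 3) * K.indicator 1 (V p) ≤
        ENNReal.ofReal (1 / d ^ 3) := by
      calc _ ≤ ∫⁻ p in upperSq, ENNReal.ofReal (1 / d ^ 3) := by
            refine setLIntegral_mono measurable_const fun p hp => ?_
            have hp0 : 0 < p.1 := hp.1.1
            calc _ ≤ ENNReal.ofReal (1 / (c * p.1 + d) ^ 3) * 1 := by
                  gcongr
                  exact Set.indicator_le_self' (by simp) _
              _ ≤ _ := by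
                  rw [mul_one]
                  gcongr
                  nlinarith
        _ = _ := by simp [volume_upperSq]
    have h2 : ENNReal.ofReal (1 / (8 * d ^ 3)) * volume (A ∩ upperSq) ≤
        ∫⁻ p in upperSq, ENNReal.ofReal (1 / (c * p.1 + d) ^ 3) *
          (A ∩ Metric.thickening δ K).indicator 1 (V p) := by
      calc _ = ∫⁻ p in upperSq, ENNReal.ofReal (1 / (8 * d ^ 3)) * A.indicator 1 p := by
            rw [lintegral_const_mul _ (measurable_one.indicator hAm), lintegral_indicator_one hAm,
              Measure.restrict_apply hAm]
        _ ≤ _ := by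
            refine setLIntegral_mono' measurableSet_upperSq fun p hp => ?_
            have hp0 : 0 < p.1 := hp.1.1
            have hp1 : p.1 < 1 := hp.1.2
            by_cases hpA : p ∈ A
            · have hmem : V p ∈ A ∩ Metric.thickening δ K :=
                ⟨(hV.mem_iff hA hp).2 hpA, Metric.mem_thickening_iff.2
                  ⟨V q, hqK, (hV.dist_le hp hq).trans_lt hδ⟩⟩
              rw [Set.indicator_of_mem hpA, Set.indicator_of_mem hmem, Pi.one_apply, Pi.one_apply]
              gcongr
              calc (c * p.1 + d) ^ 3 ≤ (2 * d) ^ 3 := by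
                    gcongr
                    nlinarith [hV.c_le_d]
                _ = 8 * d ^ 3 := by ring
            · simp [Set.indicator_of_notMem hpA]
    calc _ ≤ volume (A ∩ upperSq) * ENNReal.ofReal (1 / d ^ 3) := by gcongr
      _ = 8 * (ENNReal.ofReal (1 / (8 * d ^ 3)) * volume (A ∩ upperSq)) := by
          rw [← mul_assoc, mul_comm]
          congr 1
          rw [← ENNReal.ofReal_ofNat, ← ENNReal.ofReal_mul (by norm_num)]
          congr 1
          field_simp
      _ ≤ _ := by gcongr
  · have h0 : ∫⁻ p in upperSq,
        ENNReal.ofReal (1 / (c * p.1 + d) ^ 3) * K.indicator 1 (V p) = 0 := by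
      rw [← lintegral_zero (μ := volume.restrict upperSq)]
      refine setLIntegral_congr_fun measurableSet_upperSq fun p hp => ?_
      have : V p ∉ K := fun h => hK ⟨p, hp, h⟩
      simp [Set.indicator_of_notMem this]
    rw [h0, mul_zero]
    exact zero_le

lemma volume_mul_volume_le {A K : Set (ℝ × ℝ)} (hAm : MeasurableSet A)
    (hA : skewProd ⁻¹' A = A) (hK : IsClosed K) :
    volume (A ∩ upperSq) * volume (K ∩ upperSq) ≤ 8 * volume (K ∩ (A ∩ upperSq)) := by
  have hδ : ∀ δ > 0, volume (A ∩ upperSq) * volume (K ∩ upperSq) ≤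
      8 * (volume.restrict (A ∩ upperSq)) (Metric.thickening δ K) := by
    intro δ hδ
    obtain ⟨n, hn⟩ := exists_pow_lt_of_lt_one (show 0 < δ / 8 by positivity)
      (show (2 / 3 : ℝ) < 1 by norm_num)
    obtain ⟨κ, V, a, b, c, d, hV, hφ⟩ := exists_isReturnFamily n
    have hthick : MeasurableSet (Metric.thickening δ K) := Metric.isOpen_thickening.measurableSet
    have e1 := hφ (K.indicator 1) (measurable_one.indicator hK.measurableSet)
    have e2 := hφ ((A ∩ Metric.thickening δ K).indicator 1)
      (measurable_one.indicator (hAm.inter hthick))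
    rw [lintegral_indicator_one hK.measurableSet, Measure.restrict_apply hK.measurableSet] at e1
    rw [lintegral_indicator_one (hAm.inter hthick),
      Measure.restrict_apply (hAm.inter hthick)] at e2
    have e3 : (volume.restrict (A ∩ upperSq)) (Metric.thickening δ K) =
        volume (A ∩ Metric.thickening δ K ∩ upperSq) := by
      rw [Measure.restrict_apply hthick]
      congr 1
      ext p
      simp only [mem_inter_iff]
      tauto
    rw [e3, e1, e2, ← ENNReal.tsum_mul_left, ← ENNReal.tsum_mul_left]
    exact ENNReal.tsum_le_tsum fun i => (hV i).mul_lintegral_le hAm hA (by linarith)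
  have hfin : IsFiniteMeasure (volume.restrict (A ∩ upperSq)) := by
    refine isFiniteMeasure_restrict.2 (ne_top_of_le_ne_top ?_ (measure_mono inter_subset_right))
    simp [volume_upperSq]
  have hlim := tendsto_measure_thickening_of_isClosed (μ := volume.restrict (A ∩ upperSq))
    ⟨1, one_pos, measure_ne_top _ _⟩ hK
  have hlim' := ENNReal.Tendsto.const_mul (a := 8) hlim (Or.inr (by simp))
  rw [Measure.restrict_apply hK.measurableSet] at hlim'
  exact ge_of_tendsto hlim' (eventually_nhdsWithin_of_forall hδ)

lemma volume_upperSq_inter_eq_zero {A : Set (ℝ × ℝ)} (hAm : MeasurableSet A)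
    (hA : skewProd ⁻¹' A = A) : volume (A ∩ upperSq) = 0 ∨ volume (Aᶜ ∩ upperSq) = 0 := by
  by_contra! hcon
  obtain ⟨h1, h2⟩ := hcon
  obtain ⟨K, hKs, hK, hKpos⟩ := (hAm.compl.inter measurableSet_upperSq).exists_lt_isCompact
    (pos_iff_ne_zero.2 h2)
  have h := volume_mul_volume_le hAm hA hK.isClosed
  have e1 : K ∩ (A ∩ upperSq) = ∅ := by
    ext p
    simp only [mem_inter_iff, mem_empty_iff_false, iff_false]
    exact fun hp => (hKs hp.1).1 hp.2.1
  have e2 : K ∩ upperSq = K := inter_eq_left.2 fun p hp => (hKs hp).2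
  rw [e1, e2, measure_empty, mul_zero] at h
  exact mul_ne_zero h1 hKpos.ne' (le_antisymm h zero_le)

lemma volume_lowerSq_inter_eq_zero {A : Set (ℝ × ℝ)} (hAm : MeasurableSet A)
    (hA : skewProd ⁻¹' A = A) (h0 : volume (A ∩ upperSq) = 0) : volume (A ∩ lowerSq) = 0 := by
  have hnull : ∀ᵐ p ∂volume.restrict upperSq, p ∉ A := by
    rw [ae_iff]
    simpa [Measure.restrict_apply hAm] using h0
  have h := lintegral_lowerSq (φ := A.indicator 1) (measurable_one.indicator hAm)
  rw [lintegral_indicator_one hAm, Measure.restrict_apply hAm] at h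
  rw [h, ENNReal.tsum_eq_zero]
  intro n
  rw [← lintegral_zero (μ := volume.restrict upperSq)]
  refine lintegral_congr_ae ?_
  filter_upwards [hnull, ae_restrict_mem measurableSet_upperSq] with p hp hpQ
  have : flipBranch n p ∉ A := by
    rw [← hA, mem_preimage, skewProd_flipBranch n hpQ]
    exact hp
  simp [Set.indicator_of_notMem this]

/-! ### The invariant measure and Lebesgue measure -/

lemma upperSq_subset_Rect : upperSq ⊆ Rect :=
  prod_mono Ioo_subset_Icc_self fun _ hx => ⟨by linarith [hx.1], hx.2.le⟩

lemma lowerSq_subset_Rect : lowerSq ⊆ Rect :=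
  prod_mono Ioo_subset_Icc_self fun _ hx => ⟨hx.1.le, by linarith [hx.2]⟩

lemma skewMeasure_absolutelyContinuous : skewMeasure ≪ volume.restrict Rect := by
  refine Measure.AbsolutelyContinuous.mk fun s _ hs => ?_
  rw [skewMeasure, Measure.add_apply, add_eq_zero]
  constructor
  · exact withDensity_absolutelyContinuous _ _
      ((Measure.restrict_mono upperSq_subset_Rect le_rfl).absolutelyContinuous hs)
  · exact withDensity_absolutelyContinuous _ _
      ((Measure.restrict_mono lowerSq_subset_Rect le_rfl).absolutelyContinuous hs)

lemma skewMeasure_eq_zero {A : Set (ℝ × ℝ)} (hAm : MeasurableSet A)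
    (hu : volume (A ∩ upperSq) = 0) (hl : volume (A ∩ lowerSq) = 0) : skewMeasure A = 0 := by
  rw [skewMeasure, Measure.add_apply, add_eq_zero]
  constructor
  · exact withDensity_absolutelyContinuous _ _ (by rwa [Measure.restrict_apply hAm])
  · exact withDensity_absolutelyContinuous _ _ (by rwa [Measure.restrict_apply hAm])

lemma volume_Rect_diff : volume (Rect \ (upperSq ∪ lowerSq)) = 0 := by
  have hsub : Rect \ (upperSq ∪ lowerSq) ⊆
      ({0, 1} ×ˢ univ) ∪ (univ ×ˢ {-1, 0, 1} : Set (ℝ × ℝ)) := by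
    rintro ⟨s, b⟩ ⟨⟨⟨hs0, hs1⟩, hb0, hb1⟩, hn⟩
    by_contra hcon
    simp only [mem_union, mem_prod, mem_univ, and_true, true_and, mem_insert_iff,
      mem_singleton_iff, not_or] at hcon
    obtain ⟨⟨h0, h1⟩, h2, h3, h4⟩ := hcon
    have hs : s ∈ Ioo (0 : ℝ) 1 := ⟨lt_of_le_of_ne hs0 (Ne.symm h0), lt_of_le_of_ne hs1 h1⟩
    rcases lt_or_gt_of_ne h3 with h | h
    · exact hn (Or.inr ⟨hs, lt_of_le_of_ne hb0 (Ne.symm h2), h⟩)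
    · exact hn (Or.inl ⟨hs, h, lt_of_le_of_ne hb1 h4⟩)
  refine measure_mono_null hsub (measure_union_null ?_ ?_)
  · rw [Measure.volume_eq_prod, Measure.prod_prod, (Set.toFinite _).measure_zero, zero_mul]
  · rw [Measure.volume_eq_prod, Measure.prod_prod, (Set.toFinite {-1, 0, 1}).measure_zero, mul_zero]

lemma absolutelyContinuous_skewMeasure : volume.restrict Rect ≪ skewMeasure := by
  refine Measure.AbsolutelyContinuous.mk fun s hs h => ?_
  rw [skewMeasure, Measure.add_apply, add_eq_zero] at h
  have hu : volume.restrict upperSq s = 0 := by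
    refine withDensity_absolutelyContinuous' (by fun_prop) ?_ h.1
    filter_upwards [ae_restrict_mem measurableSet_upperSq] with p hp
    exact (ENNReal.ofReal_pos.2 (upperDensity_pos hp.1.1)).ne'
  have hl : volume.restrict lowerSq s = 0 := by
    refine withDensity_absolutelyContinuous' (by fun_prop) ?_ h.2
    filter_upwards [ae_restrict_mem measurableSet_lowerSq] with p hp
    exact (ENNReal.ofReal_pos.2 (lowerDensity_pos hp.1.1)).ne'
  rw [Measure.restrict_apply hs] at hu hl ⊢
  refine measure_mono_null (t := (s ∩ upperSq ∪ s ∩ lowerSq) ∪ Rect \ (upperSq ∪ lowerSq)) ?_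
    (measure_union_null (measure_union_null hu hl) volume_Rect_diff)
  intro p hp
  by_cases h1 : p ∈ upperSq ∪ lowerSq
  · exact Or.inl (h1.imp (fun h => ⟨hp.1, h⟩) fun h => ⟨hp.1, h⟩)
  · exact Or.inr ⟨hp.2, h1⟩

lemma volume_inter_Rect_pos {p : ℝ × ℝ} (hp : p ∈ Rect) {U : Set (ℝ × ℝ)} (hU : IsOpen U)
    (hpU : p ∈ U) : 0 < volume.restrict Rect U := by
  have hcl : p ∈ closure (Ioo (0 : ℝ) 1 ×ˢ Ioo (-1 : ℝ) 1) := by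
    rwa [closure_prod_eq, closure_Ioo (by norm_num), closure_Ioo (by norm_num)]
  have hne := mem_closure_iff.1 hcl U hU hpU
  rw [Measure.restrict_apply hU.measurableSet]
  refine ((hU.inter (isOpen_Ioo.prod isOpen_Ioo)).measure_pos volume hne).trans_le ?_
  exact measure_mono (inter_subset_inter_right _ (prod_mono Ioo_subset_Icc_self Ioo_subset_Icc_self))

lemma skewMeasure_univ_ne_zero : skewMeasure univ ≠ 0 := fun h =>
  (volume_inter_Rect_pos (p := (0, 0)) (by simp [Rect]) isOpen_univ (mem_univ _)).ne'
    (absolutelyContinuous_skewMeasure h)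

lemma skewMeasure_univ_ne_top : skewMeasure univ ≠ ⊤ := by
  have hfin : ∫⁻ _, 1 ∂skewMeasure ≠ ⊤ := by
    rw [lintegral_skewMeasure measurable_const]
    refine ENNReal.add_ne_top.2 ⟨?_, ?_⟩
    · refine ne_top_of_le_ne_top (b := ∫⁻ _ in upperSq, 1) (by simp [volume_upperSq]) ?_
      refine setLIntegral_mono measurable_const fun p hp => ?_
      have hp0 : 0 < p.1 := hp.1.1
      rw [mul_one, ENNReal.ofReal_le_one, upperDensity, div_le_one (by positivity)]
      nlinarith
    · refine ne_top_of_le_ne_top (b := ∫⁻ _ in lowerSq, 1) ?_ ?_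
      · rw [lowerSq, Measure.volume_eq_prod]
        simp
      refine setLIntegral_mono measurable_const fun p hp => ?_
      have hp0 : 0 < p.1 := hp.1.1
      rw [mul_one, ENNReal.ofReal_le_one, lowerDensity, div_le_one (by positivity)]
      nlinarith
  simpa using hfin

lemma skewMeasure_eq_zero_of_invariant {A : Set (ℝ × ℝ)} (hAm : MeasurableSet A)
    (hA : skewProd ⁻¹' A = A) : skewMeasure A = 0 ∨ skewMeasure Aᶜ = 0 := by
  have hAc : skewProd ⁻¹' Aᶜ = Aᶜ := by rw [preimage_compl, hA]
  rcases volume_upperSq_inter_eq_zero hAm hA with h | h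
  · exact Or.inl (skewMeasure_eq_zero hAm h (volume_lowerSq_inter_eq_zero hAm hA h))
  · exact Or.inr
      (skewMeasure_eq_zero hAm.compl h (volume_lowerSq_inter_eq_zero hAm.compl hAc h))

/-- **Theorem A.1.** The skew product `T : R → R` admits a unique invariant Borel probability
measure absolutely continuous with respect to Lebesgue measure on `R`; it is ergodic and its
topological support is all of `R`. -/
theorem skewProdErgodic :
    ∃ μ : Measure (ℝ × ℝ), IsProbabilityMeasure μ ∧
      μ.map skewProd = μ ∧
      μ ≪ volume.restrict Rect ∧
      (∀ ν : Measure (ℝ × ℝ), IsProbabilityMeasure ν → ν.map skewProd = ν →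
        ν ≪ volume.restrict Rect → ν = μ) ∧
      (∀ A : Set (ℝ × ℝ), MeasurableSet A → skewProd ⁻¹' A = A → μ A = 0 ∨ μ A = 1) ∧
      (∀ p ∈ Rect, ∀ U : Set (ℝ × ℝ), IsOpen U → p ∈ U → 0 < μ U) := by
  set μ : Measure (ℝ × ℝ) := (skewMeasure univ)⁻¹ • skewMeasure with hμ
  have hc0 : (skewMeasure univ)⁻¹ ≠ 0 := ENNReal.inv_ne_zero.2 skewMeasure_univ_ne_top
  have hprob : IsProbabilityMeasure μ := ⟨by
    rw [hμ, Measure.smul_apply, smul_eq_mul,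
      ENNReal.inv_mul_cancel skewMeasure_univ_ne_zero skewMeasure_univ_ne_top]⟩
  have hinv : μ.map skewProd = μ := by rw [hμ, Measure.map_smul, map_skewProd_skewMeasure]
  have hac : volume.restrict Rect ≪ μ :=
    absolutelyContinuous_skewMeasure.trans (Measure.absolutelyContinuous_smul hc0)
  have herg : ∀ A : Set (ℝ × ℝ), MeasurableSet A → skewProd ⁻¹' A = A → μ A = 0 ∨ μ Aᶜ = 0 := by
    intro A hAm hA
    simp only [hμ, Measure.smul_apply, smul_eq_mul, mul_eq_zero, hc0, false_or]
    exact skewMeasure_eq_zero_of_invariant hAm hA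
  have hErgodic : Ergodic skewProd μ :=
    { measurable := measurable_skewProd
      map_eq := hinv
      aeconst_set := fun A hAm hA => by
        rw [eventuallyConst_set]
        rcases herg A hAm hA with h | h
        · exact Or.inr (measure_eq_zero_iff_ae_notMem.1 h)
        · exact Or.inl (by simpa using measure_eq_zero_iff_ae_notMem.1 h) }
  refine ⟨μ, hprob, hinv, ?_, ?_, ?_, ?_⟩
  · exact skewMeasure_absolutelyContinuous.smul_left _
  · intro ν hν hνinv hνac
    exact hErgodic.eq_of_absolutelyContinuous ⟨measurable_skewProd, hνinv⟩ (hνac.trans hac)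
  · intro A hAm hA
    exact (herg A hAm hA).imp_right (prob_compl_eq_zero_iff hAm).1
  · intro p hp U hU hpU
    exact pos_iff_ne_zero.2 fun h => (volume_inter_Rect_pos hp hU hpU).ne' (hac h)
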